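/- arXiv:2207.07251 — 4 statements merged into one kernel-verified Lean document; each statement's English description precedes it below -/
import Mathlib

section
/- For every constant β with 0 < β < 10^{-9}, the probability that the random 8-nearest-neighbour graph O_8 on [n] is a βn-expander tends to 1 as n → ∞. -/
open Filter

attribute [local instance] Classical.propDecidable

/-- The edges of the complete graph on `Fin n`: non-diagonal unordered pairs. -/
abbrev CEdge (n : ℕ) : Type := {e : Sym2 (Fin n) // ¬ e.IsDiag}

/-- The sample space: a uniformly random ordering of the edges of `K_n`,
encoded as a bijection from positions to edges. -/
abbrev EdgeOrdering (n : ℕ) : Type := Fin (Fintype.card (CEdge n)) ≃ CEdge n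

/-- The uniform probability of an event on a finite sample space. -/
noncomputable def uprob {α : Type} [Fintype α] (P : α → Prop) : ℝ :=
  ((Finset.univ.filter P).card : ℝ) / (Fintype.card α : ℝ)

/-- The `k`-nearest-neighbour graph determined by an ordering (ranking) of the edges of `K_n`:
an edge is kept iff, at one of its endpoints, fewer than `k` incident edges have smaller rank.
(A uniformly random such ordering arises from i.i.d. continuous edge weights.) -/
noncomputable def nearestGraph (n k : ℕ) (ω : EdgeOrdering n) : Finset (CEdge n) :=
  Finset.univ.filter (fun e : CEdge n => ∃ v ∈ (e : Sym2 (Fin n)),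
    (Finset.univ.filter (fun f : CEdge n =>
      v ∈ (f : Sym2 (Fin n)) ∧ ω.symm f < ω.symm e)).card < k)

/-- The external neighbourhood of the vertex set `U` in the graph with edge set `P`:
all vertices outside `U` joined by an edge of `P` to a vertex of `U`. -/
noncomputable def extNbhd (n : ℕ) (P : Finset (CEdge n)) (U : Finset (Fin n)) :
    Finset (Fin n) :=
  Finset.univ.filter (fun w => w ∉ U ∧ ∃ u ∈ U, ∃ e ∈ P, (e : Sym2 (Fin n)) = s(u, w))

/-- All elements of `S` come before all elements of `B` in the ordering `ω`. -/
def Precedes {α : Type} {m : ℕ} (ω : Fin m ≃ α) (S B : Finset α) : Prop :=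
  ∀ e ∈ S, ∀ f ∈ B, ω.symm e < ω.symm f

section UniformProbability

variable {α : Type} [Fintype α]

lemma uprob_mono {P Q : α → Prop} (h : ∀ a, P a → Q a) : uprob P ≤ uprob Q := by
  unfold uprob
  gcongr
  exact h _

lemma uprob_le_one (P : α → Prop) : uprob P ≤ 1 :=
  div_le_one_of_le₀ (by exact_mod_cast Finset.card_le_univ _) (by positivity)

lemma uprob_exists_le {ι : Type*} (I : Finset ι) (P : ι → α → Prop) :
    uprob (fun a => ∃ i ∈ I, P i a) ≤ ∑ i ∈ I, uprob (P i) := by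
  unfold uprob
  rw [← Finset.sum_div]
  gcongr
  rw [← Nat.cast_sum]
  refine Nat.cast_le.2 (le_trans (Finset.card_le_card fun a ha => ?_) Finset.card_biUnion_le)
  simpa using ha

lemma one_sub_uprob_not_le [Nonempty α] (P : α → Prop) :
    1 - uprob (fun a => ¬ P a) ≤ uprob P := by
  have h : (Fintype.card α : ℝ) ≠ 0 := by exact_mod_cast Fintype.card_ne_zero
  have := Finset.card_filter_add_card_filter_not (s := (Finset.univ : Finset α)) P
  unfold uprob
  rw [sub_le_iff_le_add, ← add_div, le_div_iff₀ (by positivity), one_mul]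
  rw [← Nat.cast_add, Nat.cast_le, ← Finset.card_univ]
  exact this.ge.trans (le_of_eq (by congr!))

end UniformProbability

section Orderings

variable {α : Type} {m : ℕ}

/-- Two subsets of `T` of the same size are exchanged by a permutation supported on `T`. -/
lemma exists_perm_carrying {T S S' : Finset α} (hS : S ⊆ T) (hS' : S' ⊆ T)
    (hc : S.card = S'.card) :
    ∃ σ : Equiv.Perm α, (∀ x ∉ T, σ x = x) ∧
      (∀ x ∈ T, (σ x ∈ T ∧ (σ x ∈ S' ↔ x ∈ S))) := by
  have card_sub : ∀ R : Finset α, R ⊆ T →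
      Fintype.card {x : {x // x ∈ T} // x.1 ∈ R} = R.card := by
    intro R hR
    rw [← Fintype.card_coe]
    exact Fintype.card_congr
      ⟨fun x => ⟨x.1.1, x.2⟩, fun x => ⟨⟨x.1, hR x.2⟩, x.2⟩, fun _ => rfl, fun _ => rfl⟩
  have e : {x : {x // x ∈ T} // x.1 ∈ S} ≃ {x : {x // x ∈ T} // x.1 ∈ S'} :=
    Fintype.equivOfCardEq (by rw [card_sub S hS, card_sub S' hS', hc])
  refine ⟨Equiv.Perm.ofSubtype e.extendSubtype, fun x hx => ?_, fun x hx => ?_⟩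
  · exact Equiv.Perm.ofSubtype_apply_of_not_mem _ hx
  · rw [Equiv.Perm.ofSubtype_apply_of_mem _ hx]
    refine ⟨Subtype.prop _, fun h => ?_, fun h => e.extendSubtype_mem ⟨x, hx⟩ h⟩
    by_contra hn
    exact e.extendSubtype_not_mem ⟨x, hx⟩ hn h

/-- The conditional probability that `S` precedes `B`, given an event that is invariant under
permutations of `S ∪ B`, is at most the reciprocal of the number of `|S|`-subsets of `S ∪ B`. -/
lemma uprob_and_precedes_mul_choose_le [Fintype (Fin m ≃ α)] (P : (Fin m ≃ α) → Prop)
    {S B : Finset α} (hSB : Disjoint S B)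
    (hP : ∀ σ : Equiv.Perm α, (∀ x ∉ S ∪ B, σ x = x) → ∀ ω, P ω → P (ω.trans σ)) :
    uprob (fun ω : Fin m ≃ α => P ω ∧ Precedes ω S B) * (S.card + B.card).choose S.card
      ≤ uprob P := by
  set T := S ∪ B with hT
  have hTc : T.card = S.card + B.card := Finset.card_union_of_disjoint hSB
  have hle : ∀ S' ∈ T.powersetCard S.card,
      (Finset.univ.filter fun ω : Fin m ≃ α => P ω ∧ Precedes ω S B).card ≤
      (Finset.univ.filter fun ω : Fin m ≃ α => P ω ∧ Precedes ω S' (T \ S')).card := by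
    intro S' hS'
    rw [Finset.mem_powersetCard] at hS'
    obtain ⟨σ, h1, h2⟩ := exists_perm_carrying (S := S) Finset.subset_union_left hS'.1 hS'.2.symm
    have hinv : ∀ y ∈ T, σ.symm y ∈ T := by
      intro y hy
      by_contra hn
      have := h1 _ hn
      rw [Equiv.apply_symm_apply] at this
      exact hn (this ▸ hy)
    refine Finset.card_le_card_of_injOn (fun ω => ω.trans σ) ?_ ?_
    · intro ω hω
      simp only [Finset.coe_filter, Finset.mem_univ, true_and, Set.mem_ofPred_eq] at hω ⊢
      refine ⟨hP σ h1 ω hω.1, fun e he f hf => ?_⟩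
      rw [Finset.mem_sdiff] at hf
      have he' := h2 _ (hinv e (hS'.1 he))
      have hf' := h2 _ (hinv f hf.1)
      rw [Equiv.apply_symm_apply] at he' hf'
      refine hω.2 _ (he'.2.1 he) _ ?_
      have := hinv f hf.1
      rw [hT, Finset.mem_union] at this
      exact this.resolve_left fun h => hf.2 (hf'.2.2 h)
    · intro ω _ ω' _ h
      ext x
      have := congrArg (fun g : Fin m ≃ α => g x) h
      simpa using this
  have hdisj : (↑(T.powersetCard S.card) : Set (Finset α)).PairwiseDisjoint fun S' =>
      Finset.univ.filter fun ω : Fin m ≃ α => P ω ∧ Precedes ω S' (T \ S') := by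
    intro S₁ h₁ S₂ h₂ hne
    rw [Function.onFun, Finset.disjoint_left]
    intro ω hω₁ hω₂
    simp only [Finset.mem_filter, Finset.mem_univ, true_and] at hω₁ hω₂
    rw [Finset.mem_coe, Finset.mem_powersetCard] at h₁ h₂
    have hc : S₁.card = S₂.card := h₁.2.trans h₂.2.symm
    obtain ⟨x, hx, hx'⟩ := Finset.not_subset.1 fun h => hne (Finset.eq_of_subset_of_card_le h hc.ge)
    obtain ⟨y, hy, hy'⟩ :=
      Finset.not_subset.1 fun h => hne (Finset.eq_of_subset_of_card_le h hc.le).symm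
    exact lt_asymm
      (hω₁.2 x hx y (Finset.mem_sdiff.2 ⟨h₂.1 hy, hy'⟩))
      (hω₂.2 y hy x (Finset.mem_sdiff.2 ⟨h₁.1 hx, hx'⟩))
  have key : (T.powersetCard S.card).card *
      (Finset.univ.filter fun ω : Fin m ≃ α => P ω ∧ Precedes ω S B).card ≤
      (Finset.univ.filter P).card := by
    rw [← smul_eq_mul]
    refine (Finset.card_nsmul_le_sum _ _ _ hle).trans ?_
    rw [← Finset.card_biUnion hdisj]
    refine Finset.card_le_card fun ω hω => ?_
    simp only [Finset.mem_biUnion, Finset.mem_filter, Finset.mem_univ, true_and] at hω ⊢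
    exact hω.choose_spec.2.1
  rw [Finset.card_powersetCard, hTc] at key
  unfold uprob
  rw [div_mul_eq_mul_div]
  gcongr
  rw [mul_comm, ← Nat.cast_mul]
  exact Nat.cast_le.2 ((le_of_eq (by congr!)).trans key)

/-- For pairwise disjoint sets `S i`, `B i`, the events that `S i` precedes `B i` hold
simultaneously with at most the product of their probabilities. -/
lemma uprob_forall_precedes_le [Fintype (Fin m ≃ α)] {ι : Type*} (I : Finset ι)
    (S B : ι → Finset α) (s b : ℕ)
    (hs : ∀ i ∈ I, (S i).card = s) (hb : ∀ i ∈ I, (B i).card = b)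
    (hSB : ∀ i ∈ I, ∀ j ∈ I, Disjoint (S i) (B j))
    (hSS : ∀ i ∈ I, ∀ j ∈ I, i ≠ j → Disjoint (S i) (S j))
    (hBB : ∀ i ∈ I, ∀ j ∈ I, i ≠ j → Disjoint (B i) (B j)) :
    uprob (fun ω : Fin m ≃ α => ∀ i ∈ I, Precedes ω (S i) (B i)) ≤
      (1 / ((s + b).choose s : ℝ)) ^ I.card := by
  induction I using Finset.induction_on with
  | empty => simpa using uprob_le_one _
  | insert j I hj ih =>
    have mem : ∀ {i}, i ∈ I → i ∈ insert j I := Finset.mem_insert_of_mem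
    have ih := ih (fun i hi => hs i (mem hi)) (fun i hi => hb i (mem hi))
      (fun i hi l hl => hSB i (mem hi) l (mem hl)) (fun i hi l hl => hSS i (mem hi) l (mem hl))
      (fun i hi l hl => hBB i (mem hi) l (mem hl))
    have hj' := Finset.mem_insert_self j I
    have step := uprob_and_precedes_mul_choose_le
      (fun ω : Fin m ≃ α => ∀ i ∈ I, Precedes ω (S i) (B i)) (hSB j hj' j hj') (by
        intro σ hσ ω hω i hi e he f hf
        have hne : i ≠ j := fun h => hj (h ▸ hi)
        have hd : Disjoint (S i ∪ B i) (S j ∪ B j) := by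
          rw [Finset.disjoint_union_left, Finset.disjoint_union_right,
            Finset.disjoint_union_right]
          exact ⟨⟨hSS i (mem hi) j hj' hne, hSB i (mem hi) j hj'⟩,
            (hSB j hj' i (mem hi)).symm, hBB i (mem hi) j hj' hne⟩
        rw [Finset.disjoint_left] at hd
        have fix : ∀ x ∈ S i ∪ B i, σ.symm x = x := fun x hx =>
          (Equiv.symm_apply_eq σ).2 (hσ x (hd hx)).symm
        change ω.symm (σ.symm e) < ω.symm (σ.symm f)
        rw [fix e (Finset.mem_union_left _ he), fix f (Finset.mem_union_right _ hf)]
        exact hω i hi e he f hf)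
    rw [hs j hj', hb j hj'] at step
    have hpos : (0 : ℝ) < ((s + b).choose s : ℝ) := by
      exact_mod_cast Nat.choose_pos (Nat.le_add_right s b)
    rw [Finset.card_insert_of_notMem hj, pow_succ, mul_one_div, le_div_iff₀ hpos]
    refine le_trans ?_ (step.trans ih)
    gcongr
    refine uprob_mono fun ω h => ⟨fun i hi => h i (mem hi), h j hj'⟩

end Orderings

/-- If every set `t i` has at least `2 * k` elements and every point lies in at most two of the
sets, then there are pairwise disjoint `k`-subsets `S i ⊆ t i`. -/
lemma exists_disjoint_subsets {ι α : Type*} (t : ι → Finset α) (k : ℕ)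
    (hk : ∀ i, 2 * k ≤ (t i).card)
    (h2 : ∀ (a : α) (A : Finset ι), (∀ i ∈ A, a ∈ t i) → A.card ≤ 2) :
    ∃ S : ι → Finset α, (∀ i, S i ⊆ t i ∧ (S i).card = k) ∧
      Pairwise fun i j => Disjoint (S i) (S j) := by
  obtain ⟨f, hf, hft⟩ := (Finset.all_card_le_biUnion_card_iff_exists_injective
    (fun x : ι × Fin k => t x.1)).1 (by
      intro A
      set A' := A.image Prod.fst with hA'
      have h1 : A.card ≤ A'.card * k := by
        have : A ⊆ A' ×ˢ (Finset.univ : Finset (Fin k)) := fun x hx =>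
          Finset.mem_product.2 ⟨Finset.mem_image_of_mem _ hx, Finset.mem_univ _⟩
        simpa using Finset.card_le_card this
      have h3 : A'.card * (2 * k) ≤ (A.biUnion fun x => t x.1).card * 2 := by
        refine Finset.card_mul_le_card_mul (fun i a => a ∈ t i) (fun i hi => ?_) fun a _ =>
          h2 a _ fun i hi => ((Finset.mem_bipartiteBelow _).1 hi).2
        obtain ⟨x, hx, rfl⟩ := Finset.mem_image.1 hi
        refine (hk x.1).trans (Finset.card_le_card fun a ha => ?_)
        exact Finset.mem_filter.2 ⟨Finset.mem_biUnion.2 ⟨x, hx, ha⟩, ha⟩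
      linarith)
  refine ⟨fun i => Finset.univ.image fun c : Fin k => f (i, c), fun i => ⟨?_, ?_⟩, ?_⟩
  · intro a ha
    obtain ⟨c, -, rfl⟩ := Finset.mem_image.1 ha
    exact hft (i, c)
  · rw [Finset.card_image_of_injective _ fun c c' h => (Prod.ext_iff.1 (hf h)).2]
    simp
  · intro i j hij
    rw [Finset.disjoint_left]
    intro a ha hb
    obtain ⟨c, -, rfl⟩ := Finset.mem_image.1 ha
    obtain ⟨d, -, h⟩ := Finset.mem_image.1 hb
    exact hij (Prod.ext_iff.1 (hf h)).1.symm

section NearestEdges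

variable {n : ℕ}

/-- The `k` first edges at the vertex `v`. -/
noncomputable def nearEdges (k : ℕ) (ω : EdgeOrdering n) (v : Fin n) : Finset (CEdge n) :=
  Finset.univ.filter fun e => v ∈ (e : Sym2 (Fin n)) ∧ (Finset.univ.filter fun f : CEdge n =>
    v ∈ (f : Sym2 (Fin n)) ∧ ω.symm f < ω.symm e).card < k

lemma mem_nearEdges {k : ℕ} {ω : EdgeOrdering n} {v : Fin n} {e : CEdge n} :
    e ∈ nearEdges k ω v ↔ v ∈ (e : Sym2 (Fin n)) ∧ (Finset.univ.filter fun f : CEdge n =>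
      v ∈ (f : Sym2 (Fin n)) ∧ ω.symm f < ω.symm e).card < k := by
  simp [nearEdges]

lemma lt_of_mem_nearEdges_of_notMem {k : ℕ} {ω : EdgeOrdering n} {v : Fin n} {e f : CEdge n}
    (he : e ∈ nearEdges k ω v) (hf : f ∉ nearEdges k ω v) (hv : v ∈ (f : Sym2 (Fin n))) :
    ω.symm e < ω.symm f := by
  by_contra! hle
  refine hf (mem_nearEdges.2 ⟨hv, lt_of_le_of_lt (Finset.card_le_card fun g hg => ?_)
    (mem_nearEdges.1 he).2⟩)
  simp only [Finset.mem_filter, Finset.mem_univ, true_and] at hg ⊢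
  exact ⟨hg.1, hg.2.trans_le hle⟩

lemma le_card_nearEdges (k : ℕ) (ω : EdgeOrdering n) (v : Fin n)
    (hk : k ≤ (Finset.univ.filter fun e : CEdge n => v ∈ (e : Sym2 (Fin n))).card) :
    k ≤ (nearEdges k ω v).card := by
  by_contra! hlt
  obtain ⟨e, he, hen⟩ := Finset.exists_mem_notMem_of_card_lt_card (hlt.trans_le hk)
  obtain ⟨m, hm, hmin⟩ := Finset.exists_min_image
    ((Finset.univ.filter fun e : CEdge n => v ∈ (e : Sym2 (Fin n))) \ nearEdges k ω v)
    (fun e => ω.symm e) ⟨e, Finset.mem_sdiff.2 ⟨he, hen⟩⟩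
  simp only [Finset.mem_sdiff, Finset.mem_filter, Finset.mem_univ, true_and] at hm hmin
  refine hm.2 (mem_nearEdges.2 ⟨hm.1, lt_of_le_of_lt (Finset.card_le_card fun g hg => ?_) hlt⟩)
  simp only [Finset.mem_filter, Finset.mem_univ, true_and] at hg
  by_contra hgn
  exact (hmin g ⟨hg.1, hgn⟩).not_gt hg.2

/-- The edges at `v` with both endpoints in `W`. -/
noncomputable def innerEdges (W : Finset (Fin n)) (v : Fin n) : Finset (CEdge n) :=
  Finset.univ.filter fun e => v ∈ (e : Sym2 (Fin n)) ∧ ∀ w ∈ (e : Sym2 (Fin n)), w ∈ W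

/-- The edges at `v` with an endpoint outside `W`. -/
noncomputable def crossEdges (W : Finset (Fin n)) (v : Fin n) : Finset (CEdge n) :=
  Finset.univ.filter fun e => v ∈ (e : Sym2 (Fin n)) ∧ ∃ w ∈ (e : Sym2 (Fin n)), w ∉ W

lemma mem_innerEdges {W : Finset (Fin n)} {v : Fin n} {e : CEdge n} :
    e ∈ innerEdges W v ↔ v ∈ (e : Sym2 (Fin n)) ∧ ∀ w ∈ (e : Sym2 (Fin n)), w ∈ W := by
  simp [innerEdges]

lemma mem_crossEdges {W : Finset (Fin n)} {v : Fin n} {e : CEdge n} :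
    e ∈ crossEdges W v ↔ v ∈ (e : Sym2 (Fin n)) ∧ ∃ w ∈ (e : Sym2 (Fin n)), w ∉ W := by
  simp [crossEdges]

lemma card_innerEdges_le (W : Finset (Fin n)) (v : Fin n) : (innerEdges W v).card ≤ W.card := by
  refine le_trans (le_trans (le_of_eq (Finset.card_image_of_injective _
    Subtype.val_injective).symm) (Finset.card_le_card (t := W.image fun w => s(v, w)) ?_))
    Finset.card_image_le
  intro e he
  obtain ⟨e, he', rfl⟩ := Finset.mem_image.1 he
  rw [mem_innerEdges] at he'
  obtain ⟨w, hw⟩ := Sym2.mem_iff_exists.1 he'.1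
  exact Finset.mem_image.2 ⟨w, he'.2 w (hw ▸ Sym2.mem_mk_right v w), hw.symm⟩

lemma card_crossEdges {W : Finset (Fin n)} {v : Fin n} (hv : v ∈ W) :
    (crossEdges W v).card = n - W.card := by
  have : (crossEdges W v).image Subtype.val = Wᶜ.image fun w => s(v, w) := by
    ext e
    simp only [Finset.mem_image, mem_crossEdges, Finset.mem_compl]
    constructor
    · rintro ⟨e, ⟨hve, w, hw, hwW⟩, rfl⟩
      exact ⟨w, hwW, ((Sym2.mem_and_mem_iff fun h : v = w => hwW (h ▸ hv)).1 ⟨hve, hw⟩).symm⟩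
    · rintro ⟨w, hw, rfl⟩
      refine ⟨⟨s(v, w), fun h => hw ?_⟩, ⟨Sym2.mem_mk_left v w, w, Sym2.mem_mk_right v w, hw⟩, rfl⟩
      rw [Sym2.mk_isDiag_iff] at h
      exact h ▸ hv
  rw [← Finset.card_image_of_injective _ Subtype.val_injective, this,
    Finset.card_image_of_injective _ fun a b h => Sym2.congr_right.1 h, Finset.card_compl,
    Fintype.card_fin]

lemma disjoint_innerEdges_crossEdges (W : Finset (Fin n)) (v w : Fin n) :
    Disjoint (innerEdges W v) (crossEdges W w) := by
  rw [Finset.disjoint_left]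
  intro e he hf
  obtain ⟨x, hx, hxW⟩ := (mem_crossEdges.1 hf).2
  exact hxW ((mem_innerEdges.1 he).2 x hx)

lemma disjoint_crossEdges {W : Finset (Fin n)} {v w : Fin n} (hv : v ∈ W) (hw : w ∈ W)
    (hvw : v ≠ w) : Disjoint (crossEdges W v) (crossEdges W w) := by
  rw [Finset.disjoint_left]
  intro e he hf
  rw [mem_crossEdges] at he hf
  obtain ⟨x, hx, hxW⟩ := he.2
  rw [(Sym2.mem_and_mem_iff hvw).1 ⟨he.1, hf.1⟩, Sym2.mem_iff] at hx
  rcases hx with rfl | rfl <;> exact hxW (by assumption)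

lemma card_le_two_of_forall_mem_edge (e : CEdge n) {U : Finset (Fin n)} (A : Finset U)
    (hA : ∀ v ∈ A, v.1 ∈ (e : Sym2 (Fin n))) : A.card ≤ 2 := by
  rw [← Sym2.card_toFinset_of_not_isDiag e.1 e.2]
  refine Finset.card_le_card_of_injOn Subtype.val (fun v hv => ?_) Subtype.val_injective.injOn
  exact Finset.mem_coe.2 (Sym2.mem_toFinset.2 (hA v hv))

/-- If the `2 * k` nearest edges of every vertex of `U` stay inside `W`, then every vertex of `U`
has `k` edges of its own, inside `W`, preceding all its edges leaving `W`. -/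
lemma exists_precedes_of_nearEdges_subset {k : ℕ} {ω : EdgeOrdering n} {U W : Finset (Fin n)}
    (hUW : U ⊆ W) (hk : 2 * k ≤ n - W.card)
    (h : ∀ v ∈ U, nearEdges (2 * k) ω v ⊆ innerEdges W v) :
    ∃ S : U → Finset (CEdge n), (∀ v : U, S v ∈ (innerEdges W v).powersetCard k) ∧
      (Pairwise fun v w => Disjoint (S v) (S w)) ∧
        ∀ v : U, Precedes ω (S v) (crossEdges W v) := by
  obtain ⟨S, hS, hd⟩ := exists_disjoint_subsets (fun v : U => nearEdges (2 * k) ω v) k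
    (fun v => le_card_nearEdges _ ω v (by
      refine hk.trans ((card_crossEdges (hUW v.2)).ge.trans (Finset.card_le_card fun e he => ?_))
      simpa using (mem_crossEdges.1 he).1))
    (fun e A hA => card_le_two_of_forall_mem_edge e A fun v hv => (mem_nearEdges.1 (hA v hv)).1)
  refine ⟨S, fun v => Finset.mem_powersetCard.2 ⟨(hS v).1.trans (h v v.2), (hS v).2⟩, hd,
    fun v e he f hf => lt_of_mem_nearEdges_of_notMem ((hS v).1 he) (fun hn => ?_)
      (mem_crossEdges.1 hf).1⟩
  exact Finset.disjoint_left.1 (disjoint_innerEdges_crossEdges W v v) (h v v.2 hn) hf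

lemma uprob_nearEdges_subset_le {k : ℕ} {U W : Finset (Fin n)} (hUW : U ⊆ W)
    (hk : 2 * k ≤ n - W.card) :
    uprob (fun ω : EdgeOrdering n => ∀ v ∈ U, nearEdges (2 * k) ω v ⊆ innerEdges W v) ≤
      (W.card.choose k / ((k + (n - W.card)).choose k : ℝ)) ^ U.card := by
  set F := (Fintype.piFinset fun v : U => (innerEdges W v).powersetCard k).filter
    fun S => Pairwise fun v w => Disjoint (S v) (S w) with hF
  have hFc : (F.card : ℝ) ≤ (W.card.choose k : ℝ) ^ U.card := by
    have : F.card ≤ W.card.choose k ^ U.card := by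
      refine (Finset.card_filter_le _ _).trans ?_
      rw [Fintype.card_piFinset]
      refine (Finset.prod_le_pow_card _ _ (W.card.choose k) fun v _ => ?_).trans_eq (by simp)
      rw [Finset.card_powersetCard]
      exact Nat.choose_le_choose _ (card_innerEdges_le W v)
    exact_mod_cast this
  calc _ ≤ uprob (fun ω : EdgeOrdering n => ∃ S ∈ F,
        ∀ v ∈ (Finset.univ : Finset U), Precedes ω (S v) (crossEdges W v)) := by
        refine uprob_mono fun ω h => ?_
        obtain ⟨S, h1, h2, h3⟩ := exists_precedes_of_nearEdges_subset hUW hk h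
        exact ⟨S, Finset.mem_filter.2 ⟨Fintype.mem_piFinset.2 h1, h2⟩, fun v _ => h3 v⟩
    _ ≤ ∑ S ∈ F, uprob (fun ω : EdgeOrdering n =>
        ∀ v ∈ (Finset.univ : Finset U), Precedes ω (S v) (crossEdges W v)) := uprob_exists_le _ _
    _ ≤ ∑ S ∈ F, (1 / ((k + (n - W.card)).choose k : ℝ)) ^ U.card := by
        refine Finset.sum_le_sum fun S hS => ?_
        rw [hF, Finset.mem_filter, Fintype.mem_piFinset] at hS
        have hS1 := fun v => Finset.mem_powersetCard.1 (hS.1 v)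
        refine (uprob_forall_precedes_le _ S (fun v => crossEdges W v) k (n - W.card)
          (fun v _ => (hS1 v).2) (fun v _ => card_crossEdges (hUW v.2))
          (fun v _ w _ => (disjoint_innerEdges_crossEdges W v w).mono_left (hS1 v).1)
          (fun v _ w _ hvw => hS.2 hvw)
          (fun v _ w _ hvw => disjoint_crossEdges (hUW v.2) (hUW w.2)
            fun h => hvw (Subtype.ext h))).trans_eq (by simp)
    _ ≤ _ := by
        rw [Finset.sum_const, nsmul_eq_mul, one_div, inv_pow, div_pow, div_eq_mul_inv]
        gcongr

/-- A set with fewer than `2 |U|` external neighbours is contained, with its neighbourhood, in a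
set of size `3 |U|`. -/
lemma exists_nearEdges_subset_of_card_extNbhd_lt {k : ℕ} {ω : EdgeOrdering n}
    {U : Finset (Fin n)} (hn : 3 * U.card ≤ n)
    (h : (extNbhd n (nearestGraph n k ω) U).card < 2 * U.card) :
    ∃ W : Finset (Fin n), W.card = 3 * U.card ∧ U ⊆ W ∧
      ∀ v ∈ U, nearEdges k ω v ⊆ innerEdges W v := by
  obtain ⟨W, hW, -, hWc⟩ := Finset.exists_subsuperset_card_eq
    (Finset.subset_univ (U ∪ extNbhd n (nearestGraph n k ω) U)) (n := 3 * U.card)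
    (by have := Finset.card_union_le U (extNbhd n (nearestGraph n k ω) U); omega)
    (by simpa using hn)
  have hUW := Finset.subset_union_left.trans hW
  refine ⟨W, hWc, hUW, fun v hv e he => ?_⟩
  have hve := (mem_nearEdges.1 he).1
  refine mem_innerEdges.2 ⟨hve, fun w hw => ?_⟩
  by_cases hwU : w ∈ U
  · exact hUW hwU
  · refine hW (Finset.mem_union_right _ ?_)
    simp only [extNbhd, nearestGraph, Finset.mem_filter, Finset.mem_univ, true_and]
    exact ⟨hwU, v, hv, e, ⟨v, mem_nearEdges.1 he⟩,
      (Sym2.mem_and_mem_iff fun h : v = w => hwU (h ▸ hv)).1 ⟨hve, hw⟩⟩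

end NearestEdges

section Estimates

lemma choose_three_mul_le (n u : ℕ) (hu : 0 < u) :
    (n.choose (3 * u) : ℝ) ≤ ((n / u : ℝ) ^ 3) ^ u := by
  have hu' : (0 : ℝ) < u := by exact_mod_cast hu
  set r := 3 * u with hr
  have hr' : (r : ℝ) = 3 * u := by push_cast [hr]; ring
  have h1 : (r : ℝ) ^ r / r.factorial ≤ 3 ^ r := by
    refine (Real.pow_div_factorial_le_exp r (by positivity) r).trans ?_
    rw [← Real.exp_one_pow]
    gcongr
    exact Real.exp_one_lt_three.le
  have h2 : (u : ℝ) ^ r / r.factorial ≤ 1 := by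
    rw [hr', mul_pow, mul_div_assoc] at h1
    exact (mul_le_iff_le_one_right (by positivity)).1 h1
  calc (n.choose r : ℝ) ≤ n ^ r / r.factorial := Nat.choose_le_pow_div r n
    _ = (n / u : ℝ) ^ r * (u ^ r / r.factorial) := by rw [div_pow]; field_simp
    _ ≤ (n / u : ℝ) ^ r := mul_le_of_le_one_right (by positivity) h2
    _ = _ := by rw [hr, pow_mul]

lemma choose_div_choose_le (a b k : ℕ) (hb : 0 < b) :
    (a.choose k / (k + b).choose k : ℝ) ≤ (a / b : ℝ) ^ k := by
  have hb' : (0 : ℝ) < b := by exact_mod_cast hb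
  have h2 : (b : ℝ) ^ k / k.factorial ≤ (k + b).choose k := by
    refine le_trans ?_ (Nat.pow_le_choose k (k + b))
    gcongr
    omega
  calc (a.choose k / (k + b).choose k : ℝ)
      ≤ (a ^ k / k.factorial) / (b ^ k / k.factorial) := by
        gcongr
        exact Nat.choose_le_pow_div k a
    _ = _ := by rw [div_pow]; field_simp

end Estimates

/-- The probability that some set of `u` vertices has fewer than `2 * u` external neighbours. -/
lemma uprob_exists_card_extNbhd_lt_le {n u : ℕ} (hu : 0 < u) (hn : 6 * u ≤ n) (hn' : 16 ≤ n) :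
    uprob (fun ω : EdgeOrdering n => ∃ U : Finset (Fin n), U.card = u ∧
      (extNbhd n (nearestGraph n 8 ω) U).card < 2 * U.card) ≤ (10368 * (u / n : ℝ)) ^ u := by
  have hu' : (0 : ℝ) < u := by exact_mod_cast hu
  have hn0 : (0 : ℝ) < n := by exact_mod_cast (by omega : 0 < n)
  set I := (Finset.powersetCard (3 * u) (Finset.univ : Finset (Fin n))).sigma
    fun W => Finset.powersetCard u W with hI
  have hIc : (I.card : ℝ) = n.choose (3 * u) * (3 * u).choose u := by
    rw [hI, Finset.card_sigma, Finset.sum_congr rfl fun W hW => by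
      rw [Finset.card_powersetCard, (Finset.mem_powersetCard.1 hW).2]]
    simp
  have hratio : ((3 * u).choose 4 / (4 + (n - 3 * u)).choose 4 : ℝ) ≤ (6 * (u / n : ℝ)) ^ 4 := by
    refine (choose_div_choose_le _ _ 4 (by omega)).trans ?_
    gcongr
    have hN : (n : ℝ) / 2 ≤ ((n - 3 * u : ℕ) : ℝ) := by
      rw [div_le_iff₀ two_pos]
      exact_mod_cast (by omega : n ≤ (n - 3 * u) * 2)
    calc (((3 * u : ℕ) : ℝ) / (n - 3 * u : ℕ)) ≤ ((3 * u : ℕ) : ℝ) / (n / 2) := by gcongr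
      _ = _ := by push_cast; field_simp; norm_num
  calc _ ≤ uprob (fun ω : EdgeOrdering n => ∃ p ∈ I,
        ∀ v ∈ p.2, nearEdges (2 * 4) ω v ⊆ innerEdges p.1 v) := by
        refine uprob_mono fun ω h => ?_
        obtain ⟨U, hU, h⟩ := h
        obtain ⟨W, hWc, hUW, hW⟩ := exists_nearEdges_subset_of_card_extNbhd_lt (by omega) h
        exact ⟨⟨W, U⟩, Finset.mem_sigma.2 ⟨Finset.mem_powersetCard.2
          ⟨Finset.subset_univ _, hU ▸ hWc⟩, Finset.mem_powersetCard.2 ⟨hUW, hU⟩⟩, hW⟩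
    _ ≤ ∑ p ∈ I, uprob (fun ω : EdgeOrdering n =>
        ∀ v ∈ p.2, nearEdges (2 * 4) ω v ⊆ innerEdges p.1 v) := uprob_exists_le I _
    _ ≤ ∑ p ∈ I, ((6 * (u / n : ℝ)) ^ 4) ^ u := by
        refine Finset.sum_le_sum fun p hp => ?_
        rw [hI, Finset.mem_sigma, Finset.mem_powersetCard, Finset.mem_powersetCard] at hp
        obtain ⟨⟨-, hW⟩, hUW, hU⟩ := hp
        refine (uprob_nearEdges_subset_le hUW (by omega)).trans ?_
        rw [hW, hU]
        gcongr
    _ = n.choose (3 * u) * (3 * u).choose u * ((6 * (u / n : ℝ)) ^ 4) ^ u := by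
        rw [Finset.sum_const, nsmul_eq_mul, hIc]
    _ ≤ ((n / u : ℝ) ^ 3) ^ u * 8 ^ u * ((6 * (u / n : ℝ)) ^ 4) ^ u := by
        gcongr
        · exact choose_three_mul_le n u hu
        · have := Nat.choose_le_two_pow (3 * u) u
          rw [pow_mul] at this
          exact_mod_cast this
    _ = _ := by
        rw [← mul_pow, ← mul_pow]
        congr 1
        field_simp
        norm_num

lemma uprob_exists_card_extNbhd_lt_le_geometric {n u : ℕ} (hn : 16 ≤ n)
    (hu : (u : ℝ) ≤ n / 10 ^ 9) :
    uprob (fun ω : EdgeOrdering n => ∃ U : Finset (Fin n), U.card = u ∧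
      (extNbhd n (nearestGraph n 8 ω) U).card < 2 * U.card) ≤ 41472 / n * (1 / 2 : ℝ) ^ u := by
  have hn0 : (0 : ℝ) < n := by exact_mod_cast (by omega : 0 < n)
  rcases u with _ | u
  · refine (uprob_mono (Q := fun _ => False) ?_).trans ?_
    · rintro ω ⟨U, hU, h⟩
      omega
    · simp only [uprob, Finset.filter_false, Finset.card_empty, Nat.cast_zero, zero_div]
      positivity
  · rw [le_div_iff₀ (by positivity)] at hu
    have h6 : 6 * (u + 1) ≤ n := by
      have : 6 * ((u + 1 : ℕ) : ℝ) ≤ n := by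
        push_cast at hu ⊢
        nlinarith [(Nat.cast_nonneg u : (0 : ℝ) ≤ u)]
      exact_mod_cast this
    refine (uprob_exists_card_extNbhd_lt_le u.succ_pos h6 hn).trans ?_
    have hsmall : 10368 * (((u + 1 : ℕ) : ℝ) / n) ≤ 1 / 4 := by
      rw [← mul_div_assoc, div_le_iff₀ hn0]
      linarith
    have hpow : ((u + 1 : ℕ) : ℝ) ≤ 2 ^ (u + 1) := by
      exact_mod_cast Nat.lt_two_pow_self.le
    calc (10368 * (((u + 1 : ℕ) : ℝ) / n)) ^ (u + 1)
        ≤ (1 / 4) ^ u * (10368 * (2 ^ (u + 1) / n)) := by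
          rw [pow_succ]
          gcongr
      _ = _ := by
          rw [show (1 / 4 : ℝ) = 1 / 2 * (1 / 2) by norm_num, mul_pow, pow_succ, pow_succ]
          simp only [one_div, inv_pow]
          field_simp
          norm_num

/-- With high probability, the random 8-nearest-neighbour graph `O_8` is a `βn`-expander,
for any constant `0 < β < 10⁻⁹`: every vertex set `U` with `|U| ≤ βn` satisfies
`|N(U)| ≥ 2|U|`. -/
theorem stmt11 (β : ℝ) (hβ : 0 < β) (hβ' : β < 1 / 10 ^ 9) :
    Tendsto
      (fun n => uprob (fun ω : EdgeOrdering n =>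
        ∀ U : Finset (Fin n), (U.card : ℝ) ≤ β * n →
          2 * U.card ≤ (extNbhd n (nearestGraph n 8 ω) U).card))
      atTop (nhds 1) := by
  have hlower : ∀ᶠ n : ℕ in atTop, 1 - 82944 / (n : ℝ) ≤
      uprob (fun ω : EdgeOrdering n => ∀ U : Finset (Fin n), (U.card : ℝ) ≤ β * n →
        2 * U.card ≤ (extNbhd n (nearestGraph n 8 ω) U).card) := by
    filter_upwards [eventually_ge_atTop 16] with n hn
    have : Nonempty (EdgeOrdering n) := ⟨(Fintype.equivFin _).symm⟩
    have hβn : 0 ≤ β * n := by positivity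
    refine le_trans (sub_le_sub_left ?_ 1) (one_sub_uprob_not_le _)
    calc _ ≤ uprob (fun ω : EdgeOrdering n => ∃ u ∈ Finset.range (⌊β * n⌋₊ + 1),
          ∃ U : Finset (Fin n), U.card = u ∧
            (extNbhd n (nearestGraph n 8 ω) U).card < 2 * U.card) := by
          refine uprob_mono fun ω h => ?_
          push Not at h
          obtain ⟨U, hU, h⟩ := h
          exact ⟨U.card, Finset.mem_range.2 (Nat.lt_succ_of_le (Nat.le_floor hU)), U, rfl, h⟩
      _ ≤ ∑ u ∈ Finset.range (⌊β * n⌋₊ + 1), 41472 / n * (1 / 2 : ℝ) ^ u := by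
          refine (uprob_exists_le _ _).trans (Finset.sum_le_sum fun u hu => ?_)
          refine uprob_exists_card_extNbhd_lt_le_geometric hn ?_
          calc (u : ℝ) ≤ β * n :=
                (Nat.le_floor_iff hβn).1 (Nat.le_of_lt_succ (Finset.mem_range.1 hu))
            _ ≤ 1 / 10 ^ 9 * n := by gcongr
            _ = n / 10 ^ 9 := by ring
      _ ≤ 41472 / n * 2 := by
          rw [← Finset.mul_sum]
          gcongr
          exact sum_geometric_two_le _
      _ = 82944 / n := by ring
  have hlim : Tendsto (fun n : ℕ => 1 - 82944 / (n : ℝ)) atTop (nhds 1) := by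
    simpa using (tendsto_const_div_atTop_nhds_zero_nat (82944 : ℝ)).const_sub 1
  exact tendsto_of_tendsto_of_tendsto_of_le_of_le' hlim tendsto_const_nhds hlower
    (Eventually.of_forall fun n => uprob_le_one _)
end

section
/- Let s, k ≥ 1 be integers and let D be a digraph on s vertices such that for every two disjoint vertex sets A, B ⊆ V(D) with |A| ≥ k and |B| ≥ k, D contains an edge directed from A to B. Then D contains a directed path with s − 2k + 1 edges. -/
attribute [local instance] Classical.propDecidable

/-- Intermediate configurations of a depth-first search: `S` holds the finished vertices, `U` the
unvisited ones, and `l` the current path, most recent vertex first. Each step lowers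
`U.card - S.card` by one. -/
theorem exists_dfs_state {V : Type*} [Fintype V] (Adj : V → V → Prop) (n : ℕ)
    (hn : n ≤ Fintype.card V) :
    ∃ (S U : Finset V) (l : List V), Disjoint S U ∧ (∀ a ∈ S, ∀ b ∈ U, ¬ Adj a b) ∧
      l.Nodup ∧ l.IsChain (fun a b => Adj b a) ∧ (∀ a ∈ l, a ∉ S ∧ a ∉ U) ∧
      S.card + U.card + l.length = Fintype.card V ∧ U.card + n = Fintype.card V + S.card := by
  induction n with
  | zero => exact ⟨∅, Finset.univ, [], by simp⟩
  | succ n ih =>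
    obtain ⟨S, U, l, hd, hSU, hnd, hch, hl, hc, hU⟩ := ih (by omega)
    have push : ∀ u ∈ U, (u :: l).IsChain (fun a b => Adj b a) →
        ∃ (S U : Finset V) (l : List V), Disjoint S U ∧ (∀ a ∈ S, ∀ b ∈ U, ¬ Adj a b) ∧
          l.Nodup ∧ l.IsChain (fun a b => Adj b a) ∧ (∀ a ∈ l, a ∉ S ∧ a ∉ U) ∧
          S.card + U.card + l.length = Fintype.card V ∧
          U.card + (n + 1) = Fintype.card V + S.card := by
      intro u hu hchain
      have hcu := Finset.card_erase_add_one hu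
      refine ⟨S, U.erase u, u :: l, hd.mono_right (Finset.erase_subset _ _),
        fun a ha b hb => hSU a ha b (Finset.mem_of_mem_erase hb),
        List.nodup_cons.2 ⟨fun h => (hl u h).2 hu, hnd⟩, hchain, ?_, ?_, by omega⟩
      · intro a ha
        rcases List.mem_cons.1 ha with rfl | ha
        · exact ⟨Finset.disjoint_right.1 hd hu, Finset.notMem_erase _ _⟩
        · exact ⟨(hl a ha).1, fun h => (hl a ha).2 (Finset.mem_of_mem_erase h)⟩
      · rw [List.length_cons]
        omega
    cases l with
    | nil =>
      obtain ⟨u, hu⟩ := Finset.card_pos.1 (show 0 < U.card by omega)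
      exact push u hu (by simp)
    | cons v l =>
      by_cases hv : ∃ u ∈ U, Adj v u
      · obtain ⟨u, hu, hvu⟩ := hv
        exact push u hu (List.isChain_cons_cons.2 ⟨hvu, hch⟩)
      · push Not at hv
        obtain ⟨hvS, hvU⟩ := hl v List.mem_cons_self
        obtain ⟨hvl, hnd'⟩ := List.nodup_cons.1 hnd
        have hcv := Finset.card_insert_of_notMem hvS
        rw [List.length_cons] at hc
        refine ⟨insert v S, U, l, Finset.disjoint_insert_left.2 ⟨hvU, hd⟩, ?_, hnd',
          hch.tail, ?_, by omega, by omega⟩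
        · intro a ha
          rcases Finset.mem_insert.1 ha with rfl | ha
          · exact hv
          · exact hSU a ha
        · intro a ha
          obtain ⟨haS, haU⟩ := hl a (List.mem_cons_of_mem _ ha)
          refine ⟨fun h => ?_, haU⟩
          rcases Finset.mem_insert.1 h with rfl | h
          · exact hvl ha
          · exact haS h

/-- If `D` is a digraph on `s` vertices in which every two disjoint vertex sets of size at
least `k` are joined by a directed edge, then `D` contains a directed path with `s - 2k + 1`
edges (where `s - 2k + 1` is interpreted as `0` if negative). -/
theorem stmt14 {V : Type} [Fintype V] (s k : ℕ) (hs : 1 ≤ s) (hk : 1 ≤ k)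
    (hcard : Fintype.card V = s) (Adj : V → V → Prop)
    (h : ∀ A B : Finset V, Disjoint A B → k ≤ A.card → k ≤ B.card →
      ∃ a ∈ A, ∃ b ∈ B, Adj a b) :
    ∃ f : Fin (s + 1 - 2 * k + 1) → V, Function.Injective f ∧
      ∀ i : Fin (s + 1 - 2 * k), Adj (f i.castSucc) (f i.succ) := by
  by_cases hsk : s + 1 - 2 * k = 0
  · obtain ⟨v⟩ := Fintype.card_pos_iff.1 (show 0 < Fintype.card V by omega)
    rw [hsk]
    exact ⟨fun _ => v, fun _ _ _ => Subsingleton.elim (α := Fin 1) _ _, fun i => i.elim0⟩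
  obtain ⟨S, U, l, hd, hSU, hnd, hch, -, hc, hU⟩ := exists_dfs_state Adj s hcard.ge
  have hSk : S.card < k := by
    by_contra! hS
    obtain ⟨a, ha, b, hb, hab⟩ := h S U hd hS (by omega)
    exact hSU a ha b hb hab
  have hlen : s + 1 - 2 * k + 1 ≤ l.reverse.length := by
    rw [List.length_reverse]
    omega
  have hrev : l.reverse.IsChain Adj := List.isChain_reverse.2 hch
  refine ⟨fun i => l.reverse[i.val]'(i.isLt.trans_le hlen), fun i j hij => ?_, fun i => ?_⟩
  · exact Fin.ext ((List.nodup_reverse.2 hnd).getElem_inj_iff.1 hij)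
  · exact List.isChain_iff_getElem.1 hrev i.val (by have := i.isLt; omega)
end

section
/- (Pósa's lemma) Let G be a graph and let P = (v_0, v_1, …, v_t) be a longest path in G. Let R(P) denote the set of endpoints of all paths obtainable from P by a finite sequence of elementary rotations with v_0 fixed. Then |N(R(P))| ≤ 2|R(P)| − 1, where N(R(P)) is the set of vertices outside R(P) having a neighbour in R(P). -/
attribute [local instance] Classical.propDecidable

/-- A path in `G` represented as a list of distinct vertices with consecutive vertices
adjacent. -/
def IsPathList {V : Type} (G : SimpleGraph V) (l : List V) : Prop :=
  l.Nodup ∧ l.Chain' G.Adj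

/-- `Q` is obtained from `P` by an elementary rotation with the first vertex fixed:
if `P = (v_0, …, v_i, …, v_t)` and `{v_i, v_t}` is an edge of `G`, then
`Q = (v_0, …, v_i, v_t, v_{t-1}, …, v_{i+1})`. -/
def ElemRotation {V : Type} (G : SimpleGraph V) (P Q : List V) : Prop :=
  ∃ (A B : List V) (u z : V),
    P = A ++ u :: (B ++ [z]) ∧ G.Adj u z ∧ Q = A ++ u :: z :: B.reverse

namespace ElemRotation

variable {V : Type} {G : SimpleGraph V} {P Q : List V}

lemma isChain_rotate {r : V → V → Prop} (hr : ∀ a b, r a b → r b a) {A B : List V} {u z : V}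
    (h : (A ++ u :: (B ++ [z])).IsChain r) (huz : r u z) :
    (A ++ u :: z :: B.reverse).IsChain r := by
  have h1 : (A ++ [u] ++ (B ++ [z])).IsChain r := by simpa using h
  have h2 : A ++ u :: z :: B.reverse = (A ++ [u]) ++ (B ++ [z]).reverse := by simp
  rw [h2]
  rw [List.isChain_append] at h1 ⊢
  refine ⟨h1.1, ?_, ?_⟩
  · rw [List.isChain_reverse]
    exact h1.2.1.imp fun a b hab => hr a b hab
  · simpa using huz

lemma perm (h : ElemRotation G P Q) : P.Perm Q := by
  obtain ⟨A, B, u, z, rfl, -, rfl⟩ := h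
  refine List.Perm.append_left A (List.Perm.cons u ?_)
  simpa using (List.reverse_perm (B ++ [z])).symm

lemma isPathList (h : ElemRotation G P Q) (hP : IsPathList G P) : IsPathList G Q := by
  refine ⟨h.perm.nodup_iff.1 hP.1, ?_⟩
  obtain ⟨A, B, u, z, rfl, huz, rfl⟩ := h
  exact isChain_rotate (fun _ _ hab => hab.symm) hP.2 huz

lemma perm_and_isPathList (h : Relation.ReflTransGen (ElemRotation G) P Q)
    (hP : IsPathList G P) : P.Perm Q ∧ IsPathList G Q := by
  induction h with
  | refl => exact ⟨.refl _, hP⟩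
  | tail _ h ih => exact ⟨ih.1.trans h.perm, h.isPathList ih.2⟩

/-- Along rotations, the neighbours of `w` on the path do not change unless `w` or one of its
neighbours on the original path becomes an endpoint. -/
lemma isChain_of_reflTransGen {S : V → V → Prop} (hS : ∀ a b, S a b → S b a)
    (hPS : P.IsChain S) {w : V}
    (hw : ∀ Q, Relation.ReflTransGen (ElemRotation G) P Q → Q.getLast? ≠ some w)
    (hSw : ∀ Q x, Relation.ReflTransGen (ElemRotation G) P Q → Q.getLast? = some x → ¬ S w x)
    (h : Relation.ReflTransGen (ElemRotation G) P Q) :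
    Q.IsChain fun a b => (a = w ∨ b = w) → S a b := by
  induction h with
  | refl => exact hPS.imp fun a b hab _ => hab
  | tail hQ h ih =>
    have hQ' := hQ.tail h
    obtain ⟨A, B, u, z, rfl, huz, rfl⟩ := h
    refine isChain_rotate (fun a b hab hw => hS _ _ (hab hw.symm)) ih ?_
    rintro (rfl | rfl)
    · exfalso
      rw [List.isChain_append] at ih
      cases B with
      | nil =>
        exact hSw _ z hQ (by simp) ((List.isChain_cons_cons.1 ih.2.1).1 (.inl rfl))
      | cons y B =>
        exact hSw _ y hQ' (by simp [List.getLast?_cons])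
          ((List.isChain_cons_cons.1 ih.2.1).1 (.inl rfl))
    · exact absurd (by simp [List.getLast?_cons]) (hw _ hQ)

/-- Each neighbour of an endpoint is itself an endpoint or is next to an endpoint on the
original path, if that path is longest. -/
lemma exists_endpoint_rel {S : V → V → Prop} (hS : ∀ a b, S a b → S b a)
    (hPS : P.IsChain S) (hP : IsPathList G P)
    (hlong : ∀ Q : List V, IsPathList G Q → Q.length ≤ P.length) {w x : V}
    (hw : ∀ Q, Relation.ReflTransGen (ElemRotation G) P Q → Q.getLast? ≠ some w)
    (hQ : Relation.ReflTransGen (ElemRotation G) P Q) (hx : Q.getLast? = some x)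
    (hxw : G.Adj x w) :
    ∃ Q y, Relation.ReflTransGen (ElemRotation G) P Q ∧ Q.getLast? = some y ∧ S w y := by
  by_contra! hSw
  have hchain := isChain_of_reflTransGen hS hPS hw hSw hQ
  obtain ⟨hperm, hQP⟩ := perm_and_isPathList hQ hP
  by_cases hwQ : w ∈ Q
  · obtain ⟨A, C, rfl⟩ := List.append_of_mem hwQ
    rcases List.eq_nil_or_concat' C with rfl | ⟨B, z, rfl⟩
    · simp at hx
      exact hxw.ne hx.symm
    · have hz : z = x := by simpa [List.getLast?_cons] using hx
      subst hz
      rw [List.isChain_append] at hchain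
      have hrot : ElemRotation G (A ++ w :: (B ++ [z])) (A ++ w :: z :: B.reverse) :=
        ⟨A, B, w, z, rfl, hxw.symm, rfl⟩
      cases B with
      | nil =>
        exact hSw _ z hQ hx ((List.isChain_cons_cons.1 hchain.2.1).1 (.inl rfl))
      | cons y B =>
        exact hSw _ y (hQ.tail hrot) (by simp [List.getLast?_cons])
          ((List.isChain_cons_cons.1 hchain.2.1).1 (.inl rfl))
  · have hext : IsPathList G (Q ++ [w]) := by
      refine ⟨?_, ?_⟩
      · rw [List.nodup_append]
        refine ⟨hQP.1, by simp, ?_⟩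
        rintro a ha b hb rfl
        simp only [List.mem_singleton] at hb
        exact hwQ (hb ▸ ha)
      · refine List.isChain_append.2 ⟨hQP.2, by simp, ?_⟩
        simpa [hx] using hxw
    have := hlong _ hext
    have := hperm.length_eq
    simp at *
    omega

end ElemRotation

/-- In a list without repetitions, at most `2 |R| - 1` elements are next to an element of `R`,
if `R` contains the last element. -/
lemma List.Nodup.card_le_of_forall_neighbor {V : Type} [DecidableEq V] {P : List V}
    (hP : P.Nodup) {R N : Finset V} {t : V} (ht : P.getLast? = some t) (htR : t ∈ R)
    (hN : ∀ w ∈ N, ∃ x ∈ R, ∃ i : ℕ, (P[i]? = some w ∧ P[i + 1]? = some x) ∨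
      (P[i]? = some x ∧ P[i + 1]? = some w)) :
    N.card ≤ 2 * R.card - 1 := by
  have hidx : ∀ {i : ℕ} {x : V}, P[i]? = some x → P.idxOf x = i := by
    intro i x h
    obtain ⟨hi, rfl⟩ := List.getElem?_eq_some_iff.1 h
    exact hP.idxOf_getElem i hi
  have hsub : N ⊆ R.image (fun x => P.getD (P.idxOf x - 1) t) ∪
      (R.erase t).image (fun x => P.getD (P.idxOf x + 1) t) := by
    intro w hw
    obtain ⟨x, hx, i, ⟨h1, h2⟩ | ⟨h1, h2⟩⟩ := hN w hw
    · refine Finset.mem_union_left _ (Finset.mem_image.2 ⟨x, hx, ?_⟩)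
      simp [hidx h2, List.getD_eq_getElem?_getD, h1]
    · refine Finset.mem_union_right _ (Finset.mem_image.2 ⟨x, Finset.mem_erase.2 ⟨?_, hx⟩, ?_⟩)
      · rintro rfl
        rw [List.getLast?_eq_getElem?] at ht
        have := (hidx ht).symm.trans (hidx h1)
        obtain ⟨hi, -⟩ := List.getElem?_eq_some_iff.1 h2
        omega
      · simp [hidx h1, List.getD_eq_getElem?_getD, h2]
  have h1 := (Finset.card_le_card hsub).trans (Finset.card_union_le _ _)
  have h2 := Finset.card_image_le (s := R) (f := fun x => P.getD (P.idxOf x - 1) t)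
  have h3 := Finset.card_image_le (s := R.erase t) (f := fun x => P.getD (P.idxOf x + 1) t)
  have h4 := Finset.card_erase_of_mem htR
  have h5 := Finset.card_pos.2 ⟨t, htR⟩
  omega

/-- Pósa's lemma: if `P` is a longest path in `G` and `R(P)` is the set of endpoints of the
paths obtained from `P` by finite sequences of elementary rotations with the first vertex
fixed, then `|N(R(P))| ≤ 2 |R(P)| - 1`. -/
theorem stmt16 {V : Type} [Fintype V] [DecidableEq V] (G : SimpleGraph V) (P : List V)
    (hP : P ≠ [] ∧ IsPathList G P)
    (hlong : ∀ Q : List V, IsPathList G Q → Q.length ≤ P.length) :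
    (Finset.univ.filter (fun w : V =>
        w ∉ (Finset.univ.filter (fun x : V =>
          ∃ Q : List V, Relation.ReflTransGen (ElemRotation G) P Q ∧ Q.getLast? = some x)) ∧
        ∃ x, (∃ Q : List V, Relation.ReflTransGen (ElemRotation G) P Q ∧
          Q.getLast? = some x) ∧ G.Adj x w)).card ≤
      2 * (Finset.univ.filter (fun x : V =>
        ∃ Q : List V, Relation.ReflTransGen (ElemRotation G) P Q ∧
          Q.getLast? = some x)).card - 1 := by
  obtain ⟨hne, hpath⟩ := hP
  have hlast := List.getLast?_eq_some_getLast hne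
  refine hpath.1.card_le_of_forall_neighbor hlast
    (Finset.mem_filter.2 ⟨Finset.mem_univ _, P, .refl, hlast⟩) ?_
  intro w hw
  simp only [Finset.mem_filter, Finset.mem_univ, true_and, not_exists, not_and] at hw
  obtain ⟨hwR, x, ⟨Q, hQ, hx⟩, hxw⟩ := hw
  obtain ⟨Q', y, hQ', hy, hS⟩ := ElemRotation.exists_endpoint_rel
    (S := fun a b => ∃ i : ℕ, (P[i]? = some a ∧ P[i + 1]? = some b) ∨
      (P[i]? = some b ∧ P[i + 1]? = some a))
    (fun a b ⟨i, h⟩ => ⟨i, h.symm⟩)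
    (List.isChain_iff_getElem.2 fun i hi => ⟨i, .inl ⟨by simp, by simp⟩⟩)
    hpath hlong hwR hQ hx hxw
  exact ⟨y, Finset.mem_filter.2 ⟨Finset.mem_univ _, Q', hQ', hy⟩, hS⟩
end

section
/- Let ℓ, z ≥ 1 be integers and let G₀ be a z-degenerate graph on q vertices with maximum degree Δ. Then the number of paths of length ℓ (i.e., with ℓ edges) in G₀ is at most q · 2^ℓ · z^{⌈ℓ/2⌉} · Δ^{⌊ℓ/2⌋}. -/
attribute [local instance] Classical.propDecidable

/-- A graph is `z`-degenerate: every non-empty set `U` of vertices contains a vertex with at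
most `z` neighbours inside `U`. -/
def Degenerate {V : Type} (G : SimpleGraph V) [Fintype V] (z : ℕ) : Prop :=
  ∀ U : Finset V, U.Nonempty → ∃ v ∈ U, (U.filter (fun w => G.Adj v w)).card ≤ z

/-- Every degenerate graph has a vertex ranking in which each vertex has few neighbours of
smaller rank. -/
theorem Degenerate.exists_ranking {V : Type} [Fintype V] [DecidableEq V] {G : SimpleGraph V}
    {z : ℕ} (h : Degenerate G z) :
    ∃ f : V → ℕ, Function.Injective f ∧
      ∀ v, (Finset.univ.filter (fun w => G.Adj v w ∧ f w < f v)).card ≤ z := by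
  have key : ∀ n (U : Finset V), U.card = n → ∃ f : V → ℕ, Set.InjOn f U ∧
      (∀ v ∈ U, f v < n) ∧
      ∀ v ∈ U, (U.filter (fun w => G.Adj v w ∧ f w < f v)).card ≤ z := by
    intro n
    induction n with
    | zero =>
      intro U hU
      obtain rfl := Finset.card_eq_zero.mp hU
      exact ⟨fun _ => 0, by simp⟩
    | succ n ih =>
      intro U hU
      obtain ⟨v, hvU, hv⟩ := h U (Finset.card_pos.mp (by omega))
      obtain ⟨f, hinj, hlt, hf⟩ := ih (U.erase v) (by rw [Finset.card_erase_of_mem hvU]; omega)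
      refine ⟨Function.update f v n, ?_, ?_, ?_⟩
      · intro a ha b hb hab
        have ha' : a ∈ U := ha
        have hb' : b ∈ U := hb
        by_cases h1 : a = v <;> by_cases h2 : b = v
        · rw [h1, h2]
        · have := hlt b (Finset.mem_erase.mpr ⟨h2, hb'⟩)
          simp [h1, h2] at hab
          omega
        · have := hlt a (Finset.mem_erase.mpr ⟨h1, ha'⟩)
          simp [h1, h2] at hab
          omega
        · simp only [Function.update_of_ne h1, Function.update_of_ne h2] at hab
          exact hinj (by simp [h1, ha']) (by simp [h2, hb']) hab
      · intro a ha
        by_cases h1 : a = v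
        · simp [h1]
        · have := hlt a (Finset.mem_erase.mpr ⟨h1, ha⟩)
          simp [h1]
          omega
      · intro a ha
        by_cases h1 : a = v
        · subst h1
          exact (Finset.card_le_card (Finset.monotone_filter_right _ fun _ _ hx => hx.1)).trans hv
        · have haU := Finset.mem_erase.mpr ⟨h1, ha⟩
          refine (Finset.card_le_card fun x hx => ?_).trans (hf a haU)
          obtain ⟨hxU, hadj, hx⟩ := Finset.mem_filter.mp hx
          have := hlt a haU
          by_cases h2 : x = v
          · simp [h1, h2] at hx
            omega
          · simp only [Function.update_of_ne h1, Function.update_of_ne h2] at hx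
            simp [h2, hxU, hadj, hx]
  obtain ⟨f, hinj, -, hf⟩ := key _ Finset.univ rfl
  exact ⟨f, by simpa using hinj, fun v => hf v (Finset.mem_univ v)⟩

section Walks

variable {V : Type} [Fintype V] [DecidableEq V] {β : Type}

/-- The lists of vertices whose consecutive pairs satisfy the relations `R b` prescribed by a
list of labels. -/
noncomputable def labelledWalks (R : β → V → V → Prop) : List β → Finset (List V)
  | [] => Finset.univ.image fun v => [v]
  | b :: bs => (labelledWalks R bs).biUnion fun l =>
      (Finset.univ.filter fun v => ∃ w ∈ l.head?, R b v w).image fun v => v :: l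

theorem card_labelledWalks_le_of_indegree (R : β → V → V → Prop) (d : β → ℕ)
    (hd : ∀ b w, (Finset.univ.filter fun v => R b v w).card ≤ d b) (bs : List β) :
    (labelledWalks R bs).card ≤ Fintype.card V * (bs.map d).prod := by
  induction bs with
  | nil => simpa [labelledWalks] using Finset.card_image_le (s := (Finset.univ : Finset V))
  | cons b bs ih =>
    refine (Finset.card_biUnion_le_card_mul _ _ (d b) fun l _ => ?_).trans ?_
    · refine Finset.card_image_le.trans ?_
      cases l with
      | nil => simp
      | cons w t => simpa using hd b w
    · rw [List.map_cons, List.prod_cons]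
      calc _ ≤ Fintype.card V * (bs.map d).prod * d b := Nat.mul_le_mul_right _ ih
        _ = _ := by ring

theorem card_labelledWalks_le_of_outdegree (R : β → V → V → Prop) (d : β → ℕ)
    (hd : ∀ b v, (Finset.univ.filter fun w => R b v w).card ≤ d b) (bs : List β) :
    (labelledWalks R bs).card ≤ Fintype.card V * (bs.map d).prod := by
  have fibre : ∀ v, ((labelledWalks R bs).filter fun l => v ∈ l.head?).card ≤
      (bs.map d).prod := by
    induction bs with
    | nil =>
      intro v
      refine Finset.card_le_one.mpr ?_
      simp only [labelledWalks, Finset.mem_filter, Finset.mem_image]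
      rintro _ ⟨⟨a, -, rfl⟩, ha⟩ _ ⟨⟨b, -, rfl⟩, hb⟩
      simp_all
    | cons b bs ih =>
      intro v
      have hsub : ((labelledWalks R (b :: bs)).filter fun l => v ∈ l.head?) ⊆
          (Finset.univ.filter fun w => R b v w).biUnion fun w =>
            ((labelledWalks R bs).filter fun l => w ∈ l.head?).image fun l => v :: l := by
        intro l hl
        simp only [labelledWalks, Finset.mem_filter, Finset.mem_biUnion, Finset.mem_image] at hl
        obtain ⟨⟨t, ht, u, ⟨-, w, hw, hR⟩, rfl⟩, hv⟩ := hl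
        obtain rfl : u = v := by simpa using hv
        simp only [Finset.mem_filter, Finset.mem_biUnion, Finset.mem_image]
        exact ⟨w, ⟨Finset.mem_univ _, hR⟩, t, ⟨ht, hw⟩, rfl⟩
      refine (Finset.card_le_card hsub).trans ?_
      refine (Finset.card_biUnion_le_card_mul _ _ (bs.map d).prod fun w _ =>
        Finset.card_image_le.trans (ih w)).trans ?_
      rw [List.map_cons, List.prod_cons]
      exact Nat.mul_le_mul_right _ (hd b v)
  have hsub : labelledWalks R bs ⊆ Finset.univ.biUnion fun v =>
      (labelledWalks R bs).filter fun l => v ∈ l.head? := by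
    intro l hl
    have hne : l ≠ [] := by
      rintro rfl
      cases bs <;> simp [labelledWalks] at hl
    obtain ⟨v, t, rfl⟩ := List.exists_cons_of_ne_nil hne
    simp [hl]
  exact (Finset.card_le_card hsub).trans
    (Finset.card_biUnion_le_card_mul _ _ _ fun v _ => fibre v)

theorem exists_mem_labelledWalks {r : V → V → Prop} {R : β → V → V → Prop}
    (hR : ∀ v w, r v w → ∃ b, R b v w) (n : ℕ) (l : List V) (hlen : l.length = n + 1)
    (hl : l.IsChain r) : ∃ bs : List β, bs.length = n ∧ l ∈ labelledWalks R bs := by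
  induction n generalizing l with
  | zero =>
    obtain ⟨v, rfl⟩ := List.length_eq_one_iff.mp hlen
    exact ⟨[], rfl, by simp [labelledWalks]⟩
  | succ n ih =>
    match l, hlen, hl with
    | v :: w :: t, hlen, hl =>
      obtain ⟨hvw, ht⟩ := List.isChain_cons_cons.mp hl
      obtain ⟨bs, hbs, hmem⟩ := ih (w :: t) (by simpa using hlen) ht
      obtain ⟨b, hb⟩ := hR v w hvw
      refine ⟨b :: bs, by simp [hbs], ?_⟩
      simp only [labelledWalks, Finset.mem_biUnion, Finset.mem_image, Finset.mem_filter]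
      exact ⟨w :: t, hmem, v, ⟨Finset.mem_univ _, w, rfl, hb⟩, rfl⟩

end Walks

theorem pow_mul_pow_le_of_balanced {m D s t : ℕ} (hmD : m ≤ D) (hst : s ≤ t) :
    m ^ t * D ^ s ≤ m ^ ((s + t + 1) / 2) * D ^ ((s + t) / 2) := by
  obtain ⟨k, hk⟩ : ∃ k, t = (s + t + 1) / 2 + k := ⟨t - (s + t + 1) / 2, by omega⟩
  have hs : (s + t) / 2 = s + k := by omega
  calc m ^ t * D ^ s = m ^ ((s + t + 1) / 2) * (D ^ s * m ^ k) := by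
        conv_lhs => rw [hk, pow_add]
        ring
    _ ≤ m ^ ((s + t + 1) / 2) * (D ^ s * D ^ k) := by gcongr
    _ = _ := by rw [hs, pow_add]

theorem prod_map_bool (bs : List Bool) (x y : ℕ) :
    (bs.map fun b => bif b then x else y).prod = x ^ bs.count true * y ^ bs.count false := by
  induction bs with
  | nil => simp
  | cons b bs ih => cases b <;> simp [ih, pow_succ] <;> ring

/-- The number of paths of length `ℓ` (with `ℓ` edges) in a `z`-degenerate graph on `q`
vertices with maximum degree at most `Δ` is at most `q · 2^ℓ · z^⌈ℓ/2⌉ · Δ^⌊ℓ/2⌋`.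
Paths are counted as subgraphs, i.e. by their edge sets. -/
theorem stmt19 {V : Type} [Fintype V] [DecidableEq V] (ℓ z Δ : ℕ) (hℓ : 1 ≤ ℓ) (hz : 1 ≤ z)
    (G : SimpleGraph V) (hdeg : Degenerate G z)
    (hΔ : ∀ v : V, (Finset.univ.filter (fun w => G.Adj v w)).card ≤ Δ) :
    ((Finset.univ : Finset (Finset (Sym2 V))).filter (fun E =>
        ∃ l : List V, l.Nodup ∧ l.length = ℓ + 1 ∧ l.Chain' G.Adj ∧
          E = ((l.zip l.tail).map (fun p => s(p.1, p.2))).toFinset)).card ≤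
      Fintype.card V * 2 ^ ℓ * z ^ ((ℓ + 1) / 2) * Δ ^ (ℓ / 2) := by
  obtain ⟨f, hinj, hf⟩ := hdeg.exists_ranking
  set m := min z Δ
  let R : Bool → V → V → Prop := fun b v w =>
    G.Adj v w ∧ bif b then f w < f v else f v < f w
  have hdown : ∀ v, (Finset.univ.filter fun w => G.Adj v w ∧ f w < f v).card ≤ m := fun v =>
    le_min (hf v) ((Finset.card_le_card
      (Finset.monotone_filter_right _ fun _ _ hx => hx.1)).trans (hΔ v))
  have hup : ∀ v, (Finset.univ.filter fun w => G.Adj v w ∧ f v < f w).card ≤ Δ := fun v =>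
    (Finset.card_le_card (Finset.monotone_filter_right _ fun _ _ hx => hx.1)).trans (hΔ v)
  have hout : ∀ b v, (Finset.univ.filter fun w => R b v w).card ≤ bif b then m else Δ := by
    rintro (_ | _) v
    · simpa [R] using hup v
    · simpa [R] using hdown v
  have hin : ∀ b w, (Finset.univ.filter fun v => R b v w).card ≤ bif b then Δ else m := by
    rintro (_ | _) w
    · simpa [R, G.adj_comm] using hdown w
    · simpa [R, G.adj_comm] using hup w
  have hcover : ∀ v w, G.Adj v w → ∃ b, R b v w := by
    intro v w h
    rcases lt_or_gt_of_ne (hinj.ne h.ne) with h' | h'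
    · exact ⟨false, h, h'⟩
    · exact ⟨true, h, h'⟩
  have hcard : ∀ bs : List Bool, bs.length = ℓ → (labelledWalks R bs).card ≤
      Fintype.card V * (m ^ ((ℓ + 1) / 2) * Δ ^ (ℓ / 2)) := by
    intro bs hbs
    have hcount := bs.count_true_add_count_false
    rw [hbs] at hcount
    rcases le_total (bs.count false) (bs.count true) with h | h
    · refine (card_labelledWalks_le_of_outdegree R (fun b => bif b then m else Δ)
        (fun b v => by convert hout b v) bs).trans (Nat.mul_le_mul_left _ ?_)
      rw [prod_map_bool, ← hcount, add_comm (bs.count true)]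
      exact pow_mul_pow_le_of_balanced (min_le_right z Δ) h
    · refine (card_labelledWalks_le_of_indegree R (fun b => bif b then Δ else m)
        (fun b w => by convert hin b w) bs).trans (Nat.mul_le_mul_left _ ?_)
      rw [prod_map_bool, ← hcount, mul_comm]
      exact pow_mul_pow_le_of_balanced (min_le_right z Δ) h
  let edges : List V → Finset (Sym2 V) := fun l =>
    ((l.zip l.tail).map (fun p => s(p.1, p.2))).toFinset
  calc _ ≤ ((Finset.univ : Finset (List.Vector Bool ℓ)).biUnion fun bs =>
        (labelledWalks R bs.toList).image edges).card := by
        refine Finset.card_le_card fun E hE => ?_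
        obtain ⟨-, l, -, hlen, hl, rfl⟩ := Finset.mem_filter.mp hE
        obtain ⟨bs, hbs, hmem⟩ := exists_mem_labelledWalks hcover ℓ l hlen hl
        exact Finset.mem_biUnion.mpr
          ⟨⟨bs, hbs⟩, Finset.mem_univ _, Finset.mem_image.mpr ⟨l, hmem, rfl⟩⟩
    _ ≤ 2 ^ ℓ * (Fintype.card V * (m ^ ((ℓ + 1) / 2) * Δ ^ (ℓ / 2))) := by
        refine (Finset.card_biUnion_le_card_mul _ _ _ fun bs _ =>
          Finset.card_image_le.trans (hcard _ bs.toList_length)).trans ?_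
        simp
    _ ≤ 2 ^ ℓ * (Fintype.card V * (z ^ ((ℓ + 1) / 2) * Δ ^ (ℓ / 2))) := by
        gcongr
        exact min_le_left z Δ
    _ = _ := by ring
end
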